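/- Minimal increment of the dual iterate: for every ℓ ≥ 1 in the asynchronous Sinkhorn algorithm, Σ_{x∈X} μ(x)·(α^{ℓ+1}(x) − α^ℓ(x)) ≥ ε·(1 − q^ℓ). -/

import Mathlib

/-- One `u`-update of the Sinkhorn algorithm: `u(x) = μ(x) / Σ_y K(x,y) v(y)`. -/
noncomputable def uOf {X Y : Type*} [Fintype Y] (K : X → Y → ℝ) (μ : X → ℝ)
    (v : Y → ℝ) : X → ℝ :=
  fun x => μ x / ∑ y, K x y * v y

/-- One `v̂`-update of the Sinkhorn algorithm: `v̂(y) = ν(y) / Σ_x K(x,y) u(x)`. -/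
noncomputable def vhatOf {X Y : Type*} [Fintype X] (K : X → Y → ℝ) (ν : Y → ℝ)
    (u : X → ℝ) : Y → ℝ :=
  fun y => ν y / ∑ x, K x y * u x

/-- The `v`-iterates of the asynchronous Sinkhorn algorithm:
`v⁰ = v0`, `v^{ℓ+1}(y) = min (v^ℓ(y), v̂^{ℓ+1}(y))` with
`v̂^{ℓ+1} = vhatOf K ν (uOf K μ (v^ℓ))`. -/
noncomputable def sinkV {X Y : Type*} [Fintype X] [Fintype Y] (K : X → Y → ℝ)
    (μ : X → ℝ) (ν : Y → ℝ) (v0 : Y → ℝ) : ℕ → Y → ℝ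
  | 0 => v0
  | ℓ + 1 => fun y =>
      min (sinkV K μ ν v0 ℓ y) (vhatOf K ν (uOf K μ (sinkV K μ ν v0 ℓ)) y)

theorem uOf_pos {X Y : Type*} [Fintype Y] [Nonempty Y] {K : X → Y → ℝ} {μ : X → ℝ}
    {v : Y → ℝ} (hK : ∀ x y, 0 < K x y) (hμ : ∀ x, 0 < μ x) (hv : ∀ y, 0 < v y) (x : X) :
    0 < uOf K μ v x :=
  div_pos (hμ x) (Finset.sum_pos (fun y _ => mul_pos (hK x y) (hv y)) Finset.univ_nonempty)

theorem vhatOf_pos {X Y : Type*} [Fintype X] [Nonempty X] {K : X → Y → ℝ} {ν : Y → ℝ}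
    {u : X → ℝ} (hK : ∀ x y, 0 < K x y) (hν : ∀ y, 0 < ν y) (hu : ∀ x, 0 < u x) (y : Y) :
    0 < vhatOf K ν u y :=
  div_pos (hν y) (Finset.sum_pos (fun x _ => mul_pos (hK x y) (hu x)) Finset.univ_nonempty)

theorem sinkV_pos {X Y : Type*} [Fintype X] [Fintype Y] [Nonempty X] [Nonempty Y]
    {K : X → Y → ℝ} {μ : X → ℝ} {ν v0 : Y → ℝ} (hK : ∀ x y, 0 < K x y)
    (hμ : ∀ x, 0 < μ x) (hν : ∀ y, 0 < ν y) (hv0 : ∀ y, 0 < v0 y) (ℓ : ℕ) (y : Y) :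
    0 < sinkV K μ ν v0 ℓ y := by
  induction ℓ generalizing y with
  | zero => exact hv0 y
  | succ ℓ ih => exact lt_min (ih y) (vhatOf_pos hK hν (uOf_pos hK hμ ih) y)

/-- The `x`-marginal of the plan with scalings `u` and `w` is controlled by the log-increment
from `u` to the scaling computed from `w`. -/
theorem sub_marginal_le_mul_log_uOf_sub {X Y : Type*} [Fintype Y] [Nonempty Y]
    {K : X → Y → ℝ} {μ u : X → ℝ} {w : Y → ℝ} (hK : ∀ x y, 0 < K x y) (hμ : ∀ x, 0 < μ x)
    (hu : ∀ x, 0 < u x) (hw : ∀ y, 0 < w y) (x : X) :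
    μ x - ∑ y, u x * K x y * w y ≤ μ x * (Real.log (uOf K μ w x) - Real.log (u x)) := by
  have hS : 0 < ∑ y, K x y * w y :=
    Finset.sum_pos (fun y _ => mul_pos (hK x y) (hw y)) Finset.univ_nonempty
  have hu' := uOf_pos hK hμ hw x
  have hlog := Real.log_le_sub_one_of_pos (div_pos (hu x) hu')
  rw [Real.log_div (hu x).ne' hu'.ne'] at hlog
  have hmarg : ∑ y, u x * K x y * w y = μ x * (u x / uOf K μ w x) := by
    have hμx := (hμ x).ne'
    simp only [mul_assoc, ← Finset.mul_sum, uOf]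
    field_simp
  rw [hmarg]
  nlinarith [mul_le_mul_of_nonneg_left hlog (hμ x).le]

theorem async_sinkhorn_alpha_increment
    {X Y : Type*} [Fintype X] [Fintype Y] [Nonempty X] [Nonempty Y]
    (μ : X → ℝ) (ν : Y → ℝ) (hμ : ∀ x, 0 < μ x) (hν : ∀ y, 0 < ν y)
    (hμ1 : ∑ x, μ x = 1) (hν1 : ∑ y, ν y = 1)
    (C : ℝ) (hC : 0 ≤ C) (c : X → Y → ℝ) (hc : ∀ x y, 0 ≤ c x y ∧ c x y ≤ C)
    (ε : ℝ) (hε : 0 < ε)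
    (K : X → Y → ℝ) (hK : ∀ x y, K x y = Real.exp (-(c x y) / ε) * μ x * ν y)
    (v0 : Y → ℝ) (hv0 : ∀ y, 0 < v0 y)
    (v : ℕ → Y → ℝ) (hv : ∀ ℓ, v ℓ = sinkV K μ ν v0 ℓ)
    (u : ℕ → X → ℝ) (hu : ∀ ℓ, u ℓ = uOf K μ (v (ℓ - 1)))
    (vhat : ℕ → Y → ℝ) (hvhat : ∀ ℓ, vhat ℓ = vhatOf K ν (u ℓ))
    (π : ℕ → X → Y → ℝ) (hπ : ∀ ℓ x y, π ℓ x y = u ℓ x * K x y * v ℓ y)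
    (q : ℕ → ℝ) (hq : ∀ ℓ, q ℓ = ∑ x, ∑ y, π ℓ x y)
    (α : ℕ → X → ℝ) (hα : ∀ ℓ x, α ℓ x = ε * Real.log (u ℓ x)) :
    ∀ ℓ : ℕ, 1 ≤ ℓ →
      ε * (1 - q ℓ) ≤ ∑ x, μ x * (α (ℓ + 1) x - α ℓ x) := by
  intro ℓ _
  have hKpos : ∀ x y, 0 < K x y := fun x y => by
    rw [hK]
    exact mul_pos (mul_pos (Real.exp_pos _) (hμ x)) (hν y)
  have hvpos : ∀ k y, 0 < v k y := fun k y => by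
    rw [hv]
    exact sinkV_pos hKpos hμ hν hv0 k y
  have hupos : ∀ x, 0 < u ℓ x := fun x => by
    rw [hu]
    exact uOf_pos hKpos hμ (hvpos _) x
  have hsucc : u (ℓ + 1) = uOf K μ (v ℓ) := hu (ℓ + 1)
  calc ε * (1 - q ℓ) = ε * ∑ x, (μ x - ∑ y, u ℓ x * K x y * v ℓ y) := by
        simp only [hq, hπ, Finset.sum_sub_distrib, hμ1]
    _ ≤ ε * ∑ x, μ x * (Real.log (u (ℓ + 1) x) - Real.log (u ℓ x)) := by
        rw [hsucc]
        exact mul_le_mul_of_nonneg_left (Finset.sum_le_sum fun x _ =>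
          sub_marginal_le_mul_log_uOf_sub hKpos hμ hupos (hvpos ℓ) x) hε.le
    _ = ∑ x, μ x * (α (ℓ + 1) x - α ℓ x) := by
        rw [Finset.mul_sum]
        refine Finset.sum_congr rfl fun x _ => ?_
        rw [hα, hα]
        ring
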